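/- Let p ≥ 2 and θ ≥ p be reals, let u, v : ℝᴺ → ℝ be positive C² functions with Δw ≥ 0 on the set {w ≥ 0}, where w = v − λu and λ = ‖u‖_∞^{(θ−p)/(p+1)} (u bounded). Given that for f(R) = ∫_{S^{N−1}} (max(w,0))^p (Rσ) dσ there exists a sequence R_i → ∞ with f′(R_i) ≤ 0, the integration-by-parts identity (p−1)∫_{B_R} w₊^{p−2}|∇w₊|² dx ≤ (R^{N−1}/2) f′(R) holds for every R > 0. -/

import Mathlib

open MeasureTheory Real

/-- The Laplacian of a function on Euclidean space, as the sum of the pure second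
derivatives in the coordinate directions. -/
noncomputable def laplacian {N : ℕ} (f : EuclideanSpace ℝ (Fin N) → ℝ)
    (x : EuclideanSpace ℝ (Fin N)) : ℝ :=
  ∑ i : Fin N, iteratedFDeriv ℝ 2 f x ![EuclideanSpace.single i 1, EuclideanSpace.single i 1]

open Set Filter Topology Metric in
theorem hasDerivAt_max_zero_rpow {q : ℝ} (hq : 1 < q) (t : ℝ) :
    HasDerivAt (fun t : ℝ => max t 0 ^ q) (q * max t 0 ^ (q - 1)) t := by
  have off : ∀ y : ℝ, y ≠ 0 → HasDerivAt (fun t : ℝ => max t 0 ^ q) (q * max y 0 ^ (q - 1)) y := by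
    intro y hy
    rcases lt_or_gt_of_ne hy with h | h
    · rw [max_eq_right h.le, Real.zero_rpow (by linarith), mul_zero]
      refine (hasDerivAt_const y (0 : ℝ)).congr_of_eventuallyEq ?_
      filter_upwards [Iio_mem_nhds h] with z hz
      rw [max_eq_right (le_of_lt hz), Real.zero_rpow (by linarith)]
    · rw [max_eq_left h.le]
      refine (Real.hasDerivAt_rpow_const (Or.inl hy)).congr_of_eventuallyEq ?_
      filter_upwards [Ioi_mem_nhds h] with z hz
      rw [max_eq_left (le_of_lt hz)]
  by_cases ht : t = 0
  · subst ht
    refine hasDerivAt_of_hasDerivAt_of_ne off (g := fun y => q * max y 0 ^ (q - 1)) ?_ ?_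
    · exact ((continuous_id.max continuous_const).rpow_const
        fun _ => Or.inr (by linarith)).continuousAt
    · exact (continuous_const.mul ((continuous_id.max continuous_const).rpow_const
        fun _ => Or.inr (by linarith))).continuousAt
  · exact off t ht

open Set Filter Topology Metric in
theorem integral_eq_integral_Ioi_integral_sphere {E : Type*} [NormedAddCommGroup E]
    [NormedSpace ℝ E] [MeasurableSpace E] [BorelSpace E] [FiniteDimensional ℝ E] [Nontrivial E]
    (μ : Measure E) [μ.IsAddHaarMeasure] {F : E → ℝ} (hF : Integrable F μ) :
    ∫ x, F x ∂μ = ∫ r in Ioi (0 : ℝ),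
      r ^ (Module.finrank ℝ E - 1) * ∫ σ : sphere (0 : E) 1, F (r • (σ : E)) ∂μ.toSphere := by
  have hmp := μ.measurePreserving_homeomorphUnitSphereProd
  have hemb := (homeomorphUnitSphereProd E).measurableEmbedding
  let G : sphere (0 : E) 1 × Ioi (0 : ℝ) → ℝ := fun z => F ((z.2 : ℝ) • (z.1 : E))
  have hGF : ∀ x : ({0}ᶜ : Set E), G (homeomorphUnitSphereProd E x) = F x := by
    intro x
    have hx : ‖(x : E)‖ ≠ 0 := norm_ne_zero_iff.2 x.2
    simp [G, smul_smul, hx]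
  have hG : Integrable G (μ.toSphere.prod (Measure.volumeIoiPow (Module.finrank ℝ E - 1))) := by
    rw [← hmp.integrable_comp_emb hemb]
    have : Integrable (fun x : ({0}ᶜ : Set E) => F x) (μ.comap (↑)) :=
      (integrableOn_iff_comap_subtypeVal (by measurability)).1 hF.integrableOn
    exact this.congr (Eventually.of_forall fun x => (hGF x).symm)
  calc
    ∫ x, F x ∂μ = ∫ x : ({0}ᶜ : Set E), F x ∂(μ.comap (↑)) := by
      rw [integral_subtype_comap (measurableSet_singleton _).compl F, restrict_compl_singleton]
    _ = ∫ x : ({0}ᶜ : Set E), G (homeomorphUnitSphereProd E x) ∂(μ.comap (↑)) := by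
      simp only [hGF]
    _ = ∫ z, G z ∂(μ.toSphere.prod (Measure.volumeIoiPow (Module.finrank ℝ E - 1))) :=
      hmp.integral_comp hemb G
    _ = ∫ r : Ioi (0 : ℝ), ∫ σ : sphere (0 : E) 1, F ((r : ℝ) • (σ : E)) ∂μ.toSphere
          ∂(Measure.volumeIoiPow (Module.finrank ℝ E - 1)) := integral_prod_symm G hG
    _ = _ := by
      rw [Measure.volumeIoiPow, integral_withDensity_eq_integral_toReal_smul (by fun_prop) (by simp)]
      rw [← integral_subtype_comap measurableSet_Ioi (fun r : ℝ =>
        r ^ (Module.finrank ℝ E - 1) * ∫ σ : sphere (0 : E) 1, F (r • (σ : E)) ∂μ.toSphere)]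
      refine integral_congr_ae (Eventually.of_forall fun r => ?_)
      have : (0 : ℝ) ≤ (r : ℝ) ^ (Module.finrank ℝ E - 1) := pow_nonneg (le_of_lt r.2) _
      simp [ENNReal.toReal_ofReal this]

/-- Integration by parts for the field `φ(w) ∇w` against a compactly supported test function. -/
theorem integral_mul_divergence_eq_neg {N : ℕ} {w χ : EuclideanSpace ℝ (Fin N) → ℝ}
    {φ φ' : ℝ → ℝ} (hw : ContDiff ℝ 2 w) (hφ : ∀ t, HasDerivAt φ (φ' t) t) (hφ' : Continuous φ')
    (hχ : ContDiff ℝ 1 χ) (hχc : HasCompactSupport χ) :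
    ∫ x, χ x * (φ' (w x) * ∑ i, fderiv ℝ w x (EuclideanSpace.single i 1) ^ 2
        + φ (w x) * laplacian w x)
      = -∫ x, φ (w x) * ∑ i, fderiv ℝ χ x (EuclideanSpace.single i 1)
          * fderiv ℝ w x (EuclideanSpace.single i 1) := by
  have hφc : Continuous φ := continuous_iff_continuousAt.2 fun t => (hφ t).continuousAt
  have hw1 : ContDiff ℝ 1 (fderiv ℝ w) := hw.fderiv_right (by norm_num)
  have hwd : Differentiable ℝ w := hw.differentiable (by norm_num)
  have hwc : Continuous w := hw.continuous
  have hw1c : Continuous (fderiv ℝ w) := hw1.continuous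
  have hw1d : Differentiable ℝ (fderiv ℝ w) := hw1.differentiable (by norm_num)
  have hw2c : Continuous (fderiv ℝ (fderiv ℝ w)) := hw1.continuous_fderiv (by norm_num)
  have hχd : Differentiable ℝ χ := hχ.differentiable (by norm_num)
  have hχcont : Continuous χ := hχ.continuous
  have hχ1c : Continuous (fderiv ℝ χ) := hχ.continuous_fderiv (by norm_num)
  let e : Fin N → EuclideanSpace ℝ (Fin N) := fun i => EuclideanSpace.single i 1
  have hG : ∀ i x, HasFDerivAt (fun x => φ (w x) * fderiv ℝ w x (e i))
      (φ (w x) • (fderiv ℝ (fderiv ℝ w) x).flip (e i)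
        + fderiv ℝ w x (e i) • (φ' (w x) • fderiv ℝ w x)) x := by
    intro i x
    have h1 : HasFDerivAt (fun x => φ (w x)) (φ' (w x) • fderiv ℝ w x) x :=
      (hφ (w x)).comp_hasFDerivAt x (hwd x).hasFDerivAt
    have h2 : HasFDerivAt (fun x => fderiv ℝ w x (e i))
        ((fderiv ℝ (fderiv ℝ w) x).flip (e i)) x := by
      simpa using (hw1d x).hasFDerivAt.clm_apply (hasFDerivAt_const (e i) x)
    exact h1.mul h2
  have hGe : ∀ i x, fderiv ℝ (fun x => φ (w x) * fderiv ℝ w x (e i)) x (e i)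
      = φ' (w x) * fderiv ℝ w x (e i) ^ 2
        + φ (w x) * fderiv ℝ (fderiv ℝ w) x (e i) (e i) := by
    intro i x
    rw [(hG i x).fderiv]
    simp
    ring
  have hint1 : ∀ i, Integrable fun x => fderiv ℝ χ x (e i) * (φ (w x) * fderiv ℝ w x (e i)) := by
    intro i
    refine Continuous.integrable_of_hasCompactSupport (by fun_prop) ?_
    exact ((hχc.fderiv (𝕜 := ℝ)).comp_left (g := fun L => L (e i)) (by simp)).mul_right
  have hint2 : ∀ i, Integrable fun x =>
      χ x * fderiv ℝ (fun x => φ (w x) * fderiv ℝ w x (e i)) x (e i) := by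
    intro i
    simp only [hGe]
    exact Continuous.integrable_of_hasCompactSupport (by fun_prop) hχc.mul_right
  have key : ∀ i, ∫ x, χ x * fderiv ℝ (fun x => φ (w x) * fderiv ℝ w x (e i)) x (e i)
      = -∫ x, fderiv ℝ χ x (e i) * (φ (w x) * fderiv ℝ w x (e i)) := by
    intro i
    refine integral_mul_fderiv_eq_neg_fderiv_mul_of_integrable (hint1 i) (hint2 i) ?_
      (fun x _ => hχd x) (fun x _ => (hG i x).differentiableAt)
    exact Continuous.integrable_of_hasCompactSupport (by fun_prop) hχc.mul_right
  have lhs : ∀ x, χ x * (φ' (w x) * ∑ i, fderiv ℝ w x (e i) ^ 2 + φ (w x) * laplacian w x)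
      = ∑ i, χ x * fderiv ℝ (fun x => φ (w x) * fderiv ℝ w x (e i)) x (e i) := by
    intro x
    simp only [hGe, laplacian, iteratedFDeriv_two_apply, Finset.mul_sum, ← Finset.sum_add_distrib]
    rfl
  have rhs : ∀ x, φ (w x) * ∑ i, fderiv ℝ χ x (e i) * fderiv ℝ w x (e i)
      = ∑ i, fderiv ℝ χ x (e i) * (φ (w x) * fderiv ℝ w x (e i)) := by
    intro x
    rw [Finset.mul_sum]
    exact Finset.sum_congr rfl fun i _ => by ring
  calc _ = ∫ x, ∑ i, χ x * fderiv ℝ (fun x => φ (w x) * fderiv ℝ w x (e i)) x (e i) :=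
        integral_congr_ae (Filter.Eventually.of_forall lhs)
    _ = -∫ x, ∑ i, fderiv ℝ χ x (e i) * (φ (w x) * fderiv ℝ w x (e i)) := by
        rw [integral_finsetSum _ fun i _ => hint2 i, integral_finsetSum _ fun i _ => hint1 i,
          ← Finset.sum_neg_distrib]
        exact Finset.sum_congr rfl fun i _ => key i
    _ = _ := by
        congr 1
        exact integral_congr_ae (Filter.Eventually.of_forall fun x => (rhs x).symm)

/-- A `C¹` cutoff equal to `1` before `a` and to `0` after `b`. -/
theorem exists_contDiff_cutoff {a b : ℝ} (hab : a < b) :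
    ∃ s : ℝ → ℝ, ContDiff ℝ 1 s ∧ Antitone s ∧ (∀ t ≤ a, s t = 1) ∧ (∀ t, b ≤ t → s t = 0) ∧
      ∀ t, 0 ≤ s t := by
  have hba : 0 < b - a := sub_pos.2 hab
  refine ⟨fun t => 1 - Real.smoothTransition ((t - a) / (b - a)), ?_, ?_, ?_, ?_, ?_⟩
  · have := (Real.smoothTransition.contDiff (n := 1))
    have h2 : ContDiff ℝ 1 fun t : ℝ => (t - a) / (b - a) := by fun_prop
    exact contDiff_const.sub (this.comp h2)
  · intro x y hxy
    have : Real.smoothTransition ((x - a) / (b - a)) ≤ Real.smoothTransition ((y - a) / (b - a)) :=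
      Real.smoothTransition.monotone (by gcongr)
    simp only
    linarith
  · intro t ht
    have : Real.smoothTransition ((t - a) / (b - a)) = 0 :=
      Real.smoothTransition.zero_of_nonpos (div_nonpos_of_nonpos_of_nonneg (by linarith) hba.le)
    simp [this]
  · intro t ht
    have : Real.smoothTransition ((t - a) / (b - a)) = 1 :=
      Real.smoothTransition.one_of_one_le ((one_le_div hba).2 (by linarith))
    simp [this]
  · intro t
    linarith [Real.smoothTransition.le_one ((t - a) / (b - a))]

theorem continuous_integral_sphere {E : Type*} [NormedAddCommGroup E]
    [NormedSpace ℝ E] [MeasurableSpace E] [BorelSpace E] [FiniteDimensional ℝ E]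
    (μ : Measure E) [μ.IsAddHaarMeasure] {F : ℝ → E → ℝ} (hF : Continuous (Function.uncurry F)) :
    Continuous fun r => ∫ σ : Metric.sphere (0 : E) 1, F r σ ∂μ.toSphere := by
  have h : Continuous (Function.uncurry fun r (σ : Metric.sphere (0 : E) 1) => F r σ) :=
    hF.comp (continuous_fst.prodMk (continuous_subtype_val.comp continuous_snd))
  have := continuous_parametric_integral_of_continuous (μ := μ.toSphere) h isCompact_univ
  simpa using this

open Set Filter Topology Metric in
/-- Energy in a ball is bounded by the flux of `φ(w) ∇w` through the bounding sphere, when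
`φ(w) Δw ≥ 0`. -/
theorem setIntegral_ball_energy_le_flux {N : ℕ} (hN : 0 < N)
    {w : EuclideanSpace ℝ (Fin N) → ℝ}
    {φ φ' : ℝ → ℝ} (hw : ContDiff ℝ 2 w) (hφ : ∀ t, HasDerivAt φ (φ' t) t) (hφ' : Continuous φ')
    (hφ'0 : ∀ t, 0 ≤ φ' t) (hsub : ∀ x, 0 ≤ φ (w x) * laplacian w x) {R : ℝ} (hR : 0 < R) :
    ∫ x in ball (0 : EuclideanSpace ℝ (Fin N)) R,
        φ' (w x) * ∑ i, fderiv ℝ w x (EuclideanSpace.single i 1) ^ 2 ≤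
      R ^ (N - 1) * ∫ σ : sphere (0 : EuclideanSpace ℝ (Fin N)) 1,
        φ (w (R • (σ : EuclideanSpace ℝ (Fin N)))) *
          fderiv ℝ w (R • (σ : EuclideanSpace ℝ (Fin N))) (σ : EuclideanSpace ℝ (Fin N))
        ∂((volume : Measure (EuclideanSpace ℝ (Fin N))).toSphere) := by
  have : Nonempty (Fin N) := ⟨⟨0, hN⟩⟩
  have hφc : Continuous φ := continuous_iff_continuousAt.2 fun t => (hφ t).continuousAt
  have hwc : Continuous w := hw.continuous
  have hw1c : Continuous (fderiv ℝ w) := hw.continuous_fderiv (by norm_num)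
  have hlapc : Continuous (laplacian w) := by
    have hw1 : ContDiff ℝ 1 (fderiv ℝ w) := hw.fderiv_right (by norm_num)
    have hw2c : Continuous (fderiv ℝ (fderiv ℝ w)) := hw1.continuous_fderiv (by norm_num)
    unfold laplacian
    simp only [iteratedFDeriv_two_apply]
    fun_prop
  let E := EuclideanSpace ℝ (Fin N)
  let h : ℝ → ℝ := fun r => r ^ (N - 1) * ∫ σ : sphere (0 : E) 1,
    φ (w (r • (σ : E))) * fderiv ℝ w (r • (σ : E)) (σ : E) ∂((volume : Measure E).toSphere)
  have hh : Continuous h := by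
    refine (continuous_id.pow _).mul (continuous_integral_sphere volume
      (F := fun r y => φ (w (r • y)) * fderiv ℝ w (r • y) y) ?_)
    fun_prop
  change _ ≤ h R
  refine le_of_forall_pos_le_add fun ε hε => ?_
  obtain ⟨R', hRR', hle⟩ : ∃ R', R < R' ∧ ∀ r ∈ Icc R R', h r ≤ h R + ε := by
    have h1 : ∀ᶠ r in 𝓝 R, h r < h R + ε :=
      hh.continuousAt.eventually (gt_mem_nhds (by linarith))
    obtain ⟨δ, hδ, hball⟩ := Metric.eventually_nhds_iff.1 h1
    refine ⟨R + δ / 2, by linarith, fun r hr => (hball ?_).le⟩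
    rw [Real.dist_eq, abs_of_nonneg (by linarith [hr.1])]
    linarith [hr.2]
  have hR' : 0 < R' := hR.trans hRR'
  have hsq : R ^ 2 < R' ^ 2 := by gcongr
  obtain ⟨s, hs, hsanti, hs1, hs0, hsnn⟩ := exists_contDiff_cutoff hsq
  have hsd : ∀ t, HasDerivAt s (deriv s t) t := fun t =>
    (hs.differentiable (by norm_num) t).hasDerivAt
  have hs'c : Continuous (deriv s) := hs.continuous_deriv (by norm_num)
  have hs'np : ∀ t, deriv s t ≤ 0 := fun t => hsanti.deriv_nonpos
  let χ : E → ℝ := fun x => s (‖x‖ ^ 2)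
  have hχ : ContDiff ℝ 1 χ := hs.comp (contDiff_norm_sq ℝ)
  have hχcont : Continuous χ := hχ.continuous
  have hχc : HasCompactSupport χ := by
    refine HasCompactSupport.intro (isCompact_closedBall (0 : E) R') fun x hx => ?_
    have hx' : R' < ‖x‖ := by simpa using hx
    exact hs0 _ (by gcongr)
  have hχ1 : ∀ x ∈ ball (0 : E) R, χ x = 1 := by
    intro x hx
    have hx' : ‖x‖ < R := by simpa using hx
    exact hs1 _ (by gcongr)
  have hχf : ∀ x y, fderiv ℝ χ x y = 2 * deriv s (‖x‖ ^ 2) * inner ℝ x y := by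
    intro x y
    have := (hsd (‖x‖ ^ 2)).comp_hasFDerivAt x (hasStrictFDerivAt_norm_sq x).hasFDerivAt
    rw [show χ = s ∘ fun x => ‖x‖ ^ 2 from rfl, this.fderiv]
    simp
    ring
  let En : E → ℝ := fun x => φ' (w x) * ∑ i, fderiv ℝ w x (EuclideanSpace.single i 1) ^ 2
  have hEn : Continuous En := by fun_prop
  have hEn0 : ∀ x, 0 ≤ En x := fun x =>
    mul_nonneg (hφ'0 _) (Finset.sum_nonneg fun i _ => sq_nonneg _)
  have hχE : Integrable fun x => χ x * En x :=
    (hχcont.mul hEn).integrable_of_hasCompactSupport hχc.mul_right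
  have step1 : ∫ x in ball (0 : E) R, En x ≤ ∫ x, χ x * En x := by
    calc ∫ x in ball (0 : E) R, En x = ∫ x in ball (0 : E) R, χ x * En x :=
          setIntegral_congr_fun measurableSet_ball fun x hx => by simp [hχ1 x hx]
      _ ≤ ∫ x, χ x * En x := setIntegral_le_integral hχE
          (Eventually.of_forall fun x => mul_nonneg (hsnn _) (hEn0 x))
  have step2 : ∫ x, χ x * En x ≤ ∫ x, χ x * (En x + φ (w x) * laplacian w x) := by
    refine integral_mono hχE ?_ fun x => ?_
    · exact Continuous.integrable_of_hasCompactSupport (by fun_prop) hχc.mul_right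
    · have := mul_nonneg (hsnn (‖x‖ ^ 2)) (hsub x)
      simp only [χ, mul_add] at this ⊢
      linarith
  let F : E → ℝ := fun x => -(2 * deriv s (‖x‖ ^ 2)) * (φ (w x) * fderiv ℝ w x x)
  have hsum : ∀ x, ∑ i, fderiv ℝ χ x (EuclideanSpace.single i 1)
      * fderiv ℝ w x (EuclideanSpace.single i 1)
      = 2 * deriv s (‖x‖ ^ 2) * fderiv ℝ w x x := by
    intro x
    have hx : x = ∑ i, x i • EuclideanSpace.single i (1 : ℝ) := by
      ext j
      simp [Finset.sum_apply, Pi.single_apply]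
    conv_rhs => rw [show fderiv ℝ w x x = fderiv ℝ w x (∑ i, x i • EuclideanSpace.single i (1 : ℝ))
      from by rw [← hx]]
    rw [map_sum, Finset.mul_sum]
    refine Finset.sum_congr rfl fun i _ => ?_
    rw [hχf, map_smul, EuclideanSpace.inner_single_right]
    simp
    ring
  have step3 : ∫ x, χ x * (En x + φ (w x) * laplacian w x) = ∫ x, F x := by
    rw [integral_mul_divergence_eq_neg hw hφ hφ' hχ hχc, ← integral_neg]
    refine integral_congr_ae (Eventually.of_forall fun x => ?_)
    simp only [hsum, F]
    ring
  have hs'zero : ∀ t, t < R ^ 2 ∨ R' ^ 2 < t → deriv s t = 0 := by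
    rintro t (ht | ht)
    · have : s =ᶠ[𝓝 t] fun _ => 1 := by
        filter_upwards [Iio_mem_nhds ht] with y hy using hs1 y (le_of_lt hy)
      rw [this.deriv_eq]; simp
    · have : s =ᶠ[𝓝 t] fun _ => 0 := by
        filter_upwards [Ioi_mem_nhds ht] with y hy using hs0 y (le_of_lt hy)
      rw [this.deriv_eq]; simp
  have hF : Integrable F := by
    refine Continuous.integrable_of_hasCompactSupport (by fun_prop) ?_
    refine HasCompactSupport.intro (isCompact_closedBall (0 : E) R') fun x hx => ?_
    have hx' : R' < ‖x‖ := by simpa using hx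
    have : deriv s (‖x‖ ^ 2) = 0 := hs'zero _ (Or.inr (by gcongr))
    simp [F, this]
  let k : ℝ → ℝ := fun r => -(deriv s (r ^ 2) * (2 * r))
  have hk : Continuous k := by fun_prop
  have step4 : ∫ x, F x = ∫ r in Ioi (0 : ℝ), k r * h r := by
    rw [integral_eq_integral_Ioi_integral_sphere volume hF, finrank_euclideanSpace,
      Fintype.card_fin]
    refine setIntegral_congr_fun measurableSet_Ioi fun r hr => ?_
    have hr0 : 0 < r := hr
    have : ∀ σ : sphere (0 : E) 1, F (r • (σ : E)) =
        k r * (φ (w (r • (σ : E))) * fderiv ℝ w (r • (σ : E)) (σ : E)) := by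
      intro σ
      have hn : ‖r • (σ : E)‖ = r := by simp [norm_smul, abs_of_pos hr0]
      simp only [F, k, hn, map_smul, smul_eq_mul]
      ring
    simp only [this, integral_const_mul, h]
    ring
  have step5 : ∫ r in Ioi (0 : ℝ), k r * h r = ∫ r in R..R', k r * h r := by
    rw [intervalIntegral.integral_of_le hRR'.le, ← integral_Icc_eq_integral_Ioc]
    have hsubset : Icc R R' ⊆ Ioi 0 := fun r hr => lt_of_lt_of_le hR hr.1
    refine setIntegral_eq_of_subset_of_forall_sdiff_eq_zero measurableSet_Ioi hsubset ?_
    rintro r ⟨hr0, hr⟩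
    have hr0 : 0 < r := hr0
    have : deriv s (r ^ 2) = 0 := by
      apply hs'zero
      by_cases h1 : r < R
      · left; gcongr
      · right
        have : R' < r := by
          by_contra h2
          exact hr ⟨not_lt.1 h1, not_lt.1 h2⟩
        gcongr
    simp [k, this]
  have step6 : ∫ r in R..R', k r * h r ≤ ∫ r in R..R', k r * (h R + ε) := by
    refine intervalIntegral.integral_mono_on hRR'.le ((hk.mul hh).intervalIntegrable _ _)
      ((hk.mul continuous_const).intervalIntegrable _ _) fun r hr => ?_
    refine mul_le_mul_of_nonneg_left (hle r hr) ?_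
    have : 0 < r := lt_of_lt_of_le hR hr.1
    have := mul_nonneg (neg_nonneg.2 (hs'np (r ^ 2))) (by positivity : 0 ≤ 2 * r)
    simp only [k]
    linarith
  have step7 : ∫ r in R..R', k r = 1 := by
    have hd : ∀ r ∈ uIcc R R', HasDerivAt (fun r => -s (r ^ 2)) (k r) r := by
      intro r _
      have : HasDerivAt (fun r : ℝ => r ^ 2) (2 * r) r := by simpa using hasDerivAt_pow 2 r
      exact ((hsd (r ^ 2)).comp r this).neg
    rw [intervalIntegral.integral_eq_sub_of_hasDerivAt hd (hk.intervalIntegrable _ _),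
      hs1 _ le_rfl, hs0 _ le_rfl]
    norm_num
  calc _ ≤ ∫ r in R..R', k r * (h R + ε) :=
        step1.trans (step2.trans ((step3.trans (step4.trans step5)).le.trans step6))
    _ = h R + ε := by rw [intervalIntegral.integral_mul_const, step7, one_mul]

open Set Filter Topology Metric in
theorem hasDerivAt_integral_sphere_max_zero_rpow {E : Type*} [NormedAddCommGroup E]
    [NormedSpace ℝ E] [MeasurableSpace E] [BorelSpace E] [FiniteDimensional ℝ E]
    (μ : Measure E) [μ.IsAddHaarMeasure] {w : E → ℝ} (hw : ContDiff ℝ 1 w) {p : ℝ} (hp : 1 < p)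
    (R : ℝ) :
    HasDerivAt (fun r => ∫ σ : sphere (0 : E) 1, max (w (r • (σ : E))) 0 ^ p ∂μ.toSphere)
      (∫ σ : sphere (0 : E) 1, p * max (w (R • (σ : E))) 0 ^ (p - 1) *
        fderiv ℝ w (R • (σ : E)) (σ : E) ∂μ.toSphere) R := by
  have hwc : Continuous w := hw.continuous
  have hw1c : Continuous (fderiv ℝ w) := hw.continuous_fderiv (by norm_num)
  let F' : ℝ → sphere (0 : E) 1 → ℝ := fun r σ =>
    p * max (w (r • (σ : E))) 0 ^ (p - 1) * fderiv ℝ w (r • (σ : E)) (σ : E)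
  have hcont : ∀ {q : ℝ}, 0 ≤ q →
      Continuous fun z : ℝ × sphere (0 : E) 1 => max (w (z.1 • (z.2 : E))) 0 ^ q := fun hq =>
    Continuous.rpow_const (by fun_prop) fun _ => Or.inr hq
  have hF'c : Continuous (Function.uncurry F') := by
    have := hcont (q := p - 1) (by linarith)
    change Continuous fun z : ℝ × sphere (0 : E) 1 =>
      p * max (w (z.1 • (z.2 : E))) 0 ^ (p - 1) * fderiv ℝ w (z.1 • (z.2 : E)) (z.2 : E)
    fun_prop
  have hFc : ∀ r : ℝ, Continuous fun σ : sphere (0 : E) 1 => max (w (r • (σ : E))) 0 ^ p :=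
    fun r => (hcont (q := p) (by linarith)).comp (Continuous.prodMk_right r)
  obtain ⟨C, hC⟩ := ((isCompact_closedBall R 1).prod
    (isCompact_univ (X := sphere (0 : E) 1))).exists_bound_of_continuousOn hF'c.continuousOn
  refine (hasDerivAt_integral_of_dominated_loc_of_deriv_le (μ := μ.toSphere) (F' := F')
    (bound := fun _ => C) (closedBall_mem_nhds R one_pos)
    (Eventually.of_forall fun r => (hFc r).aestronglyMeasurable) ?_ ?_ ?_
    (integrable_const C) ?_).2
  · exact (hFc R).integrable_of_hasCompactSupport (HasCompactSupport.of_compactSpace _)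
  · exact (hF'c.comp (Continuous.prodMk_right R)).aestronglyMeasurable
  · exact Eventually.of_forall fun σ r hr => hC (r, σ) ⟨hr, mem_univ _⟩
  · refine Eventually.of_forall fun σ r _ => ?_
    have h1 : HasDerivAt (fun r : ℝ => r • (σ : E)) (σ : E) r := by
      simpa using (hasDerivAt_id r).smul_const (σ : E)
    have h2 : HasDerivAt (fun r : ℝ => w (r • (σ : E))) (fderiv ℝ w (r • (σ : E)) (σ : E)) r :=
      ((hw.differentiable (by norm_num) _).hasFDerivAt).comp_hasDerivAt r h1
    exact (hasDerivAt_max_zero_rpow hp _).comp r h2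

theorem norm_sq_gradient_eq_sum {N : ℕ} (w : EuclideanSpace ℝ (Fin N) → ℝ)
    (x : EuclideanSpace ℝ (Fin N)) :
    ‖gradient w x‖ ^ 2 = ∑ i, fderiv ℝ w x (EuclideanSpace.single i 1) ^ 2 := by
  rw [EuclideanSpace.real_norm_sq_eq]
  refine Finset.sum_congr rfl fun i _ => ?_
  rw [← inner_gradient_left, EuclideanSpace.inner_single_right]
  simp

open Set Filter Topology in
theorem gradient_max_zero_of_pos {E : Type*} [NormedAddCommGroup E] [InnerProductSpace ℝ E]
    [CompleteSpace E] {w : E → ℝ} {x : E} (hw : ContinuousAt w x) (hx : 0 < w x) :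
    gradient (fun y => max (w y) 0) x = gradient w x := by
  refine Filter.EventuallyEq.gradient_eq ?_
  filter_upwards [hw.eventually (lt_mem_nhds hx)] with y hy using max_eq_left (le_of_lt hy)

open Set Filter Topology in
theorem gradient_max_zero_of_nonpos {E : Type*} [NormedAddCommGroup E] [InnerProductSpace ℝ E]
    [CompleteSpace E] {w : E → ℝ} {x : E} (hx : w x ≤ 0) :
    gradient (fun y => max (w y) 0) x = 0 := by
  have hmin : IsLocalMin (fun y => max (w y) 0) x :=
    Eventually.of_forall fun y => by simp [max_eq_right hx]
  simp [gradient, hmin.fderiv_eq_zero]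

open Set Filter Topology Metric in
/-- The energy inequality for `max w 0` in a ball, with the flux through the sphere written as an
integral over the unit sphere. -/
theorem setIntegral_ball_max_zero_energy_le_flux {N : ℕ} (hN : 0 < N)
    {w : EuclideanSpace ℝ (Fin N) → ℝ} (hw : ContDiff ℝ 2 w)
    (hsub : ∀ x, 0 ≤ w x → 0 ≤ laplacian w x) {p : ℝ} (hp : 2 ≤ p) {R : ℝ} (hR : 0 < R) :
    (p - 1) * ∫ x in ball (0 : EuclideanSpace ℝ (Fin N)) R,
        max (w x) 0 ^ (p - 2) * ‖gradient (fun y => max (w y) 0) x‖ ^ 2 ≤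
      R ^ (N - 1) * ∫ σ : sphere (0 : EuclideanSpace ℝ (Fin N)) 1,
        max (w (R • (σ : EuclideanSpace ℝ (Fin N)))) 0 ^ (p - 1) *
          fderiv ℝ w (R • (σ : EuclideanSpace ℝ (Fin N))) (σ : EuclideanSpace ℝ (Fin N))
        ∂((volume : Measure (EuclideanSpace ℝ (Fin N))).toSphere) := by
  have hwc : Continuous w := hw.continuous
  have hw1c : Continuous (fderiv ℝ w) := hw.continuous_fderiv (by norm_num)
  let E := EuclideanSpace ℝ (Fin N)
  let S : E → ℝ := fun x => ∑ i, fderiv ℝ w x (EuclideanSpace.single i 1) ^ 2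
  have hS : Continuous S := by fun_prop
  have hS0 : ∀ x, 0 ≤ S x := fun x => Finset.sum_nonneg fun i _ => sq_nonneg _
  let D : sphere (0 : E) 1 → ℝ := fun σ => fderiv ℝ w (R • (σ : E)) (σ : E)
  have hD : Continuous D := by fun_prop
  have hmax : ∀ {q : ℝ}, 0 ≤ q → Continuous fun t : ℝ => max t 0 ^ q := fun hq =>
    (continuous_id.max continuous_const).rpow_const fun _ => Or.inr hq
  have hmax1 : ∀ q : ℝ, Continuous fun t : ℝ => (1 + max t 0) ^ q := fun q =>
    (continuous_const.add (continuous_id.max continuous_const)).rpow_const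
      fun t => Or.inl (by linarith [le_max_right t 0] : 0 < 1 + max t 0).ne'
  have hdom : ∀ {a b : ℝ}, 0 ≤ a → a ≤ b → ∀ t : ℝ, max t 0 ^ a ≤ (1 + max t 0) ^ b := by
    intro a b ha hab t
    have h0 : 0 ≤ max t 0 := le_max_right _ _
    exact (Real.rpow_le_rpow h0 (by linarith) ha).trans
      (Real.rpow_le_rpow_of_exponent_le (by linarith) hab)
  have strict : ∀ q : ℝ, 2 < q →
      (q - 1) * ∫ x in ball (0 : E) R, max (w x) 0 ^ (q - 2) * S x ≤
        R ^ (N - 1) * ∫ σ : sphere (0 : E) 1, max (w (R • (σ : E))) 0 ^ (q - 1) * D σ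
          ∂((volume : Measure E).toSphere) := by
    intro q hq
    have hφ : ∀ t, HasDerivAt (fun t : ℝ => max t 0 ^ (q - 1)) ((q - 1) * max t 0 ^ (q - 2)) t := by
      intro t
      convert hasDerivAt_max_zero_rpow (q := q - 1) (by linarith) t using 3
      ring
    have := setIntegral_ball_energy_le_flux hN hw hφ
      (continuous_const.mul (hmax (by linarith)))
      (fun t => mul_nonneg (by linarith) (Real.rpow_nonneg (le_max_right _ _) _)) ?_ hR
    · simp only [mul_assoc, integral_const_mul] at this
      exact this
    · intro x
      rcases le_total 0 (w x) with h | h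
      · exact mul_nonneg (Real.rpow_nonneg (le_max_right _ _) _) (hsub x h)
      · simp [max_eq_right h, Real.zero_rpow (by linarith : q - 1 ≠ 0)]
  let q : ℕ → ℝ := fun n => p + 1 / ((n : ℝ) + 1)
  have hqp : ∀ n, p < q n := fun n => by
    have : 0 < 1 / ((n : ℝ) + 1) := by positivity
    simp only [q]; linarith
  have hqp1 : ∀ n, q n ≤ p + 1 := fun n => by
    have : 1 / ((n : ℝ) + 1) ≤ 1 := by
      rw [div_le_one (by positivity)]
      linarith [Nat.cast_nonneg (α := ℝ) n]
    simp only [q]; linarith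
  have hq : Tendsto q atTop (𝓝 p) := by
    simpa [q] using (tendsto_const_nhds (x := p)).add (tendsto_one_div_add_atTop_nhds_zero_nat (𝕜 := ℝ))
  have limL : Tendsto (fun n => ∫ x in ball (0 : E) R, max (w x) 0 ^ (q n - 2) * S x) atTop
      (𝓝 (∫ x in ball (0 : E) R,
        max (w x) 0 ^ (p - 2) * ‖gradient (fun y => max (w y) 0) x‖ ^ 2)) := by
    refine tendsto_integral_of_dominated_convergence
      (fun x => (1 + max (w x) 0) ^ (p - 1) * S x) (fun n => ?_) ?_ (fun n => ?_) ?_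
    · exact (((hmax (by linarith [hqp n])).comp hwc).mul hS).aestronglyMeasurable
    · exact ((((hmax1 _).comp hwc).mul hS).continuousOn.integrableOn_compact
        (isCompact_closedBall (0 : E) R)).mono_set ball_subset_closedBall
    · refine Eventually.of_forall fun x => ?_
      rw [Real.norm_of_nonneg (mul_nonneg (Real.rpow_nonneg (le_max_right _ _) _) (hS0 x))]
      exact mul_le_mul_of_nonneg_right
        (hdom (by linarith [hqp n]) (by linarith [hqp1 n]) _) (hS0 x)
    · refine Eventually.of_forall fun x => ?_
      rcases lt_or_ge 0 (w x) with h | h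
      · rw [gradient_max_zero_of_pos hwc.continuousAt h, norm_sq_gradient_eq_sum]
        have hpos : max (w x) 0 ≠ 0 := by rw [max_eq_left h.le]; exact h.ne'
        exact ((Real.continuousAt_const_rpow hpos).tendsto.comp
          (hq.sub_const 2)).mul_const (S x)
      · rw [gradient_max_zero_of_nonpos h]
        have : ∀ n, max (w x) 0 ^ (q n - 2) * S x = 0 := fun n => by
          rw [max_eq_right h, Real.zero_rpow (by linarith [hqp n]), zero_mul]
        simp [this]
  have limR : Tendsto (fun n => ∫ σ : sphere (0 : E) 1, max (w (R • (σ : E))) 0 ^ (q n - 1) * D σ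
      ∂((volume : Measure E).toSphere)) atTop
      (𝓝 (∫ σ : sphere (0 : E) 1, max (w (R • (σ : E))) 0 ^ (p - 1) * D σ
        ∂((volume : Measure E).toSphere))) := by
    have hwR : Continuous fun σ : sphere (0 : E) 1 => w (R • (σ : E)) := by fun_prop
    refine tendsto_integral_of_dominated_convergence
      (fun σ => (1 + max (w (R • (σ : E))) 0) ^ p * |D σ|) (fun n => ?_) ?_ (fun n => ?_) ?_
    · exact (((hmax (by linarith [hqp n])).comp hwR).mul hD).aestronglyMeasurable
    · exact (((hmax1 _).comp hwR).mul hD.abs).integrable_of_hasCompactSupport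
        (HasCompactSupport.of_compactSpace _)
    · refine Eventually.of_forall fun σ => ?_
      rw [norm_mul, Real.norm_eq_abs, Real.norm_eq_abs,
        abs_of_nonneg (Real.rpow_nonneg (le_max_right _ _) _)]
      exact mul_le_mul_of_nonneg_right
        (hdom (by linarith [hqp n]) (by linarith [hqp1 n]) _) (abs_nonneg _)
    · refine Eventually.of_forall fun σ => ?_
      exact ((Real.continuousAt_const_rpow' (by linarith : p - 1 ≠ 0)).tendsto.comp
        (hq.sub_const 1)).mul_const (D σ)
  exact le_of_tendsto_of_tendsto' ((hq.sub_const 1).mul limL) (limR.const_mul (R ^ (N - 1)))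
    fun n => strict (q n) (by linarith [hqp n])

theorem stmt_17 (N : ℕ) (p θ : ℝ) (hp : 2 ≤ p) (hpθ : p ≤ θ)
    (u v : EuclideanSpace ℝ (Fin N) → ℝ)
    (hu : ContDiff ℝ 2 u) (hv : ContDiff ℝ 2 v)
    (hupos : ∀ x, 0 < u x) (hvpos : ∀ x, 0 < v x)
    (hubdd : BddAbove (Set.range u))
    (lam : ℝ) (hlam : lam = (⨆ x, u x) ^ ((θ - p) / (p + 1)))
    (w wplus : EuclideanSpace ℝ (Fin N) → ℝ)
    (hw : ∀ x, w x = v x - lam * u x)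
    (hwplus : ∀ x, wplus x = max (w x) 0)
    (hsubharm : ∀ x, 0 ≤ w x → 0 ≤ laplacian w x)
    (f : ℝ → ℝ)
    (hf : ∀ R : ℝ, f R =
      ∫ σ : Metric.sphere (0 : EuclideanSpace ℝ (Fin N)) 1,
        (wplus (R • (σ : EuclideanSpace ℝ (Fin N)))) ^ p ∂((volume :
          Measure (EuclideanSpace ℝ (Fin N))).toSphere))
    (hseq : ∃ R : ℕ → ℝ, Filter.Tendsto R Filter.atTop Filter.atTop ∧
      ∀ i, deriv f (R i) ≤ 0) :
    ∀ R : ℝ, 0 < R →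
      (p - 1) * ∫ x in Metric.ball (0 : EuclideanSpace ℝ (Fin N)) R,
          (wplus x) ^ (p - 2) * ‖gradient wplus x‖ ^ 2 ≤
        R ^ ((N : ℝ) - 1) / 2 * deriv f R := by
  intro R hR
  obtain rfl : w = fun x => v x - lam * u x := funext hw
  obtain rfl : wplus = fun x => max (v x - lam * u x) 0 := funext hwplus
  obtain rfl : f = _ := funext hf
  rcases Nat.eq_zero_or_pos N with rfl | hN
  · have h0 : (volume : Measure (EuclideanSpace ℝ (Fin 0))).toSphere = 0 :=
      (Measure.toSphere_eq_zero_iff _).2 inferInstance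
    have hg : ∀ x, gradient (fun x => max (v x - lam * u x) 0) x = 0 :=
      fun x => Subsingleton.elim _ _
    simp [h0, hg]
  have hw2 : ContDiff ℝ 2 fun x => v x - lam * u x := hv.sub (contDiff_const.mul hu)
  have energy := setIntegral_ball_max_zero_energy_le_flux hN hw2 hsubharm hp hR
  have hderiv := (hasDerivAt_integral_sphere_max_zero_rpow
    (volume : Measure (EuclideanSpace ℝ (Fin N))) (hw2.of_le (by norm_num))
    (by linarith : 1 < p) R).deriv
  simp only [mul_assoc, integral_const_mul] at hderiv
  rw [hderiv]
  have hRpow : R ^ ((N : ℝ) - 1) = R ^ (N - 1) := by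
    rw [← Real.rpow_natCast, Nat.cast_pred hN]
  rw [hRpow]
  refine energy.trans ?_
  have hflux := (mul_nonneg (by linarith : 0 ≤ p - 1)
    (integral_nonneg fun x => mul_nonneg (Real.rpow_nonneg (le_max_right _ _) _)
      (sq_nonneg _))).trans energy
  nlinarith [mul_nonneg (by linarith : 0 ≤ p - 2) hflux]
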